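/- For every nonnegative integer N and every nonzero complex number q that is not a root of unity, Σ_{m,n≥0} q^{Q(m,n)+m+3n} [3(N-2n-m)+2 choose m]_q [2(N-2n-m)+n+1 choose n]_{q³} + Σ_{m,n≥0} q^{Q(m,n)+3m+6n+1} [3(N-2n-m) choose m]_q [2(N-2n-m)+n choose n]_{q³} = Σ_{l=0}^{N} q^{3·C(N-2l,2)} [N+1 choose 2l+1]_{q³} (-q;q⁶)_{l+1} (-q⁵;q⁶)_l, where C(a,2) = a(a-1)/2 denotes the binomial coefficient and a Gaussian binomial with negative top entry is 0. -/

import Mathlib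

/-- The finite q-Pochhammer symbol `(a;q)_n`. -/
noncomputable def qPoch (a q : ℂ) (n : ℕ) : ℂ :=
  ∏ j ∈ Finset.range n, (1 - a * q ^ j)

/-- The infinite q-Pochhammer symbol `(a;q)_∞`. -/
noncomputable def qPochInf (a q : ℂ) : ℂ :=
  ∏' j : ℕ, (1 - a * q ^ j)

/-- `1/(q;q)_n` for an integer `n`, with the convention that it is `0` for `n < 0`. -/
noncomputable def qPochInvZ (q : ℂ) (n : ℤ) : ℂ :=
  if 0 ≤ n then (qPoch q q n.toNat)⁻¹ else 0

/-- The q-trinomial coefficient `(L, b; a; q)_2`. -/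
noncomputable def qTrinomial (L : ℕ) (b a : ℤ) (q : ℂ) : ℂ :=
  ∑' n : ℕ, q ^ ((n : ℤ) * ((n : ℤ) + b)) * qPoch q q L * qPochInvZ q (n : ℤ) *
    qPochInvZ q ((n : ℤ) + a) * qPochInvZ q ((L : ℤ) - 2 * (n : ℤ) - a)

/-- The q-trinomial coefficient `T_n(L, a; q)`, where `s` is a fixed square root of `q`. -/
noncomputable def qTriT (n : ℤ) (L : ℕ) (a : ℤ) (q s : ℂ) : ℂ :=
  s ^ ((L : ℤ) * ((L : ℤ) - n) - a * (a - n)) * qTrinomial L (a - n) a q⁻¹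

/-- The Gaussian (q-binomial) coefficient `[N choose k]_q`, zero unless `0 ≤ k ≤ N`. -/
noncomputable def qBinom (N k : ℤ) (q : ℂ) : ℂ :=
  if 0 ≤ k ∧ k ≤ N then
    qPoch q q N.toNat * (qPoch q q k.toNat)⁻¹ * (qPoch q q (N - k).toNat)⁻¹
  else 0

/-- The quadratic form `Q(m,n) = 2m² + 6mn + 6n²` from Capparelli's theorems. -/
def Qcap (m n : ℕ) : ℕ := 2 * m ^ 2 + 6 * m * n + 6 * n ^ 2

namespace CapAux

lemma qPoch_succ (a q : ℂ) (n : ℕ) : qPoch a q (n + 1) = qPoch a q n * (1 - a * q ^ n) := by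
  simp [qPoch, Finset.prod_range_succ]

lemma qPoch_zero (a q : ℂ) : qPoch a q 0 = 1 := by simp [qPoch]

lemma qPoch_ne {q : ℂ} (h : ∀ k : ℕ, 0 < k → q ^ k ≠ 1) (n : ℕ) : qPoch q q n ≠ 0 := by
  rw [qPoch, Finset.prod_ne_zero_iff]
  intro j _ h0
  apply h (j + 1) (by omega)
  rw [pow_succ]
  linear_combination -h0

lemma qB_nat (q : ℂ) (j k : ℕ) :
    qBinom ((j : ℤ) + k) k q = qPoch q q (j + k) * (qPoch q q k)⁻¹ * (qPoch q q j)⁻¹ := by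
  have h1 : ((j : ℤ) + k).toNat = j + k := by omega
  have h2 : ((j : ℤ) + k - k).toNat = j := by omega
  rw [qBinom, if_pos (by omega), h1, h2]
  simp

lemma qB_lt (q : ℂ) {A k : ℤ} (h : A < k) : qBinom A k q = 0 := by
  rw [qBinom, if_neg (by omega)]

lemma qB_neg (q : ℂ) {A k : ℤ} (h : k < 0) : qBinom A k q = 0 := by
  rw [qBinom, if_neg (by omega)]

lemma qB_self {q : ℂ} (h : ∀ k : ℕ, 0 < k → q ^ k ≠ 1) {A : ℤ} (hA : 0 ≤ A) :
    qBinom A A q = 1 := by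
  obtain ⟨k, rfl⟩ := Int.eq_ofNat_of_zero_le hA
  have := qB_nat q 0 k
  have h1 := qPoch_ne h k
  simp only [Nat.cast_zero, zero_add, qPoch_zero] at this
  rw [this]; field_simp

lemma qB_zero {q : ℂ} (h : ∀ k : ℕ, 0 < k → q ^ k ≠ 1) {A : ℤ} (hA : 0 ≤ A) :
    qBinom A 0 q = 1 := by
  obtain ⟨k, rfl⟩ := Int.eq_ofNat_of_zero_le hA
  have := qB_nat q k 0
  have h1 := qPoch_ne h k
  simp only [Nat.cast_zero, add_zero, qPoch_zero] at this
  rw [this]; field_simp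

/-- `(1 - q^(A-k)) [A,k] = (1 - q^A) [A-1,k]`. -/
lemma absorb {q : ℂ} (h : ∀ k : ℕ, 0 < k → q ^ k ≠ 1) (A k : ℤ) :
    (1 - q ^ A) * qBinom (A - 1) k q = (1 - q ^ (A - k)) * qBinom A k q := by
  rcases lt_or_ge k 0 with hk | hk
  · simp [qB_neg q hk]
  rcases lt_or_ge A k with hA | hA
  · simp [qB_lt q hA, qB_lt q (show A - 1 < k by omega)]
  obtain ⟨k, rfl⟩ := Int.eq_ofNat_of_zero_le hk
  obtain ⟨j, hj⟩ := Int.eq_ofNat_of_zero_le (sub_nonneg.2 hA)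
  obtain rfl : A = (j : ℤ) + k := by omega
  cases j with
  | zero => simp [qB_lt]
  | succ j =>
    have e1 : ((j + 1 : ℕ) : ℤ) + k - 1 = (j : ℤ) + k := by push_cast; ring
    have e2 : ((j + 1 : ℕ) : ℤ) + k - k = ((j + 1 : ℕ) : ℤ) := by ring
    have e3 : ((j + 1 : ℕ) : ℤ) + k = ((j + 1 + k : ℕ) : ℤ) := by push_cast; ring
    rw [e1, e2, qB_nat, qB_nat, e3, zpow_natCast, zpow_natCast,
      show j + 1 + k = (j + k) + 1 by ring, qPoch_succ, qPoch_succ]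
    have h1 := qPoch_ne h k
    have h2 := qPoch_ne h j
    have h3 : (1 - q * q ^ j) ≠ 0 := by
      have := h (j + 1) (by omega)
      intro h0; apply this; rw [pow_succ]; linear_combination -h0
    field_simp
    ring

lemma absorb2 {q : ℂ} (hq : q ≠ 0) (h : ∀ k : ℕ, 0 < k → q ^ k ≠ 1) (A k : ℤ) :
    (1 - q ^ A) * qBinom (A - 1) (k - 1) q = (1 - q ^ k) * qBinom A k q := by
  rcases lt_or_ge k 0 with hk | hk
  · simp [qB_neg q hk, qB_neg q (show k - 1 < 0 by omega)]
  rcases lt_or_ge A k with hA | hA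
  · simp [qB_lt q hA, qB_lt q (show A - 1 < k - 1 by omega)]
  obtain ⟨k, rfl⟩ := Int.eq_ofNat_of_zero_le hk
  obtain ⟨j, hj⟩ := Int.eq_ofNat_of_zero_le (sub_nonneg.2 hA)
  obtain rfl : A = (j : ℤ) + k := by omega
  cases k with
  | zero => simp [qB_neg]
  | succ k =>
    have e1 : (j : ℤ) + ((k + 1 : ℕ) : ℤ) - 1 = (j : ℤ) + k := by push_cast; ring
    have e2 : ((k + 1 : ℕ) : ℤ) - 1 = k := by push_cast; ring
    have e3 : (j : ℤ) + ((k + 1 : ℕ) : ℤ) = ((j + (k + 1) : ℕ) : ℤ) := by push_cast; ring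
    rw [e1, e2, qB_nat, qB_nat, e3, zpow_natCast, zpow_natCast,
      show j + (k + 1) = (j + k) + 1 by ring, qPoch_succ, qPoch_succ]
    have h1 := qPoch_ne h k
    have h2 := qPoch_ne h j
    have h3 : (1 - q * q ^ k) ≠ 0 := by
      have := h (k + 1) (by omega)
      intro h0; apply this; rw [pow_succ]; linear_combination -h0
    field_simp
    ring

lemma zpow_ne_one {q : ℂ} (h : ∀ k : ℕ, 0 < k → q ^ k ≠ 1) {A : ℤ} (hA : A ≠ 0) :
    q ^ A ≠ 1 := by
  rcases lt_or_gt_of_ne hA with h1 | h1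
  · have := h (-A).toNat (by omega)
    rw [← zpow_natCast, show (((-A).toNat : ℕ) : ℤ) = -A by omega, zpow_neg] at this
    intro h0; apply this; rw [h0, inv_one]
  · have := h A.toNat (by omega)
    rwa [← zpow_natCast, show ((A.toNat : ℕ) : ℤ) = A by omega] at this

lemma pascal1 {q : ℂ} (hq : q ≠ 0) (h : ∀ k : ℕ, 0 < k → q ^ k ≠ 1) (A k : ℤ)
    (h0 : A = 0 → k ≠ 0) :
    qBinom A k q = qBinom (A - 1) k q + q ^ (A - k) * qBinom (A - 1) (k - 1) q := by
  by_cases hA : A = 0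
  · subst hA
    rcases lt_or_gt_of_ne (h0 rfl) with h1 | h1
    · simp [qB_neg q h1, qB_neg q (show k - 1 < 0 by omega)]
    · rw [qB_lt q h1, qB_lt q (show (0 : ℤ) - 1 < k by omega),
        qB_lt q (show (0 : ℤ) - 1 < k - 1 by omega)]; simp
  · have hne : (1 - q ^ A) ≠ 0 := fun h2 => zpow_ne_one h hA (by linear_combination -h2)
    apply mul_left_cancel₀ hne
    have e : q ^ (A - k) * q ^ k = q ^ A := by rw [← zpow_add₀ hq]; congr 1; ring
    linear_combination -absorb h A k - q ^ (A - k) * absorb2 hq h A k + e * qBinom A k q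

lemma pascal2 {q : ℂ} (hq : q ≠ 0) (h : ∀ k : ℕ, 0 < k → q ^ k ≠ 1) (A k : ℤ)
    (h0 : A = 0 → k ≠ 0) :
    qBinom A k q = q ^ k * qBinom (A - 1) k q + qBinom (A - 1) (k - 1) q := by
  by_cases hA : A = 0
  · subst hA
    rcases lt_or_gt_of_ne (h0 rfl) with h1 | h1
    · simp [qB_neg q h1, qB_neg q (show k - 1 < 0 by omega)]
    · rw [qB_lt q h1, qB_lt q (show (0 : ℤ) - 1 < k by omega),
        qB_lt q (show (0 : ℤ) - 1 < k - 1 by omega)]; simp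
  · have hne : (1 - q ^ A) ≠ 0 := fun h2 => zpow_ne_one h hA (by linear_combination -h2)
    apply mul_left_cancel₀ hne
    have e : q ^ (A - k) * q ^ k = q ^ A := by rw [← zpow_add₀ hq]; congr 1; ring
    linear_combination -q ^ k * absorb h A k - absorb2 hq h A k + e * qBinom A k q

lemma cube_nr {q : ℂ} (h : ∀ k : ℕ, 0 < k → q ^ k ≠ 1) : ∀ k : ℕ, 0 < k → (q ^ 3) ^ k ≠ 1 := by
  intro k hk; rw [← pow_mul]; exact h _ (by omega)

/-- The summand. -/
noncomputable def T (q : ℂ) (N a b c d : ℤ) (x : ℤ × ℤ) : ℂ :=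
  q ^ (2 * x.1 ^ 2 + 6 * x.1 * x.2 + 6 * x.2 ^ 2 + a * x.1 + b * x.2) *
    qBinom (3 * (N - 2 * x.2 - x.1) + c) x.1 q *
    qBinom (2 * (N - 2 * x.2 - x.1) + x.2 + d) x.2 (q ^ 3)

/-- The double sum. -/
noncomputable def S (q : ℂ) (N a b c d : ℤ) : ℂ := ∑' x : ℤ × ℤ, T q N a b c d x

lemma T_zero (q : ℂ) (N a b c d : ℤ) (x : ℤ × ℤ)
    (h : ¬ (0 ≤ x.1 ∧ 0 ≤ x.2 ∧ 0 ≤ 2 * (N - 2 * x.2 - x.1) + d)) : T q N a b c d x = 0 := by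
  unfold T
  by_cases h1 : x.1 < 0
  · simp [qB_neg q h1]
  by_cases h2 : x.2 < 0
  · simp [qB_neg _ h2]
  · rw [qB_lt (q ^ 3) (show 2 * (N - 2 * x.2 - x.1) + x.2 + d < x.2 by omega)]; simp

lemma T_supp (q : ℂ) (N a b c d : ℤ) : (Function.support (T q N a b c d)).Finite := by
  apply Set.Finite.subset (Set.finite_Icc ((0 : ℤ), (0 : ℤ)) (2 * |N| + |d|, 2 * |N| + |d|))
  intro x hx
  by_contra hn
  apply hx
  apply T_zero
  rintro ⟨h1, h2, h3⟩
  apply hn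
  have := le_abs_self N
  have := le_abs_self d
  have := abs_nonneg N
  simp only [Set.mem_Icc, Prod.le_def]
  refine ⟨⟨h1, h2⟩, ?_, ?_⟩ <;> omega

lemma T_summable (q : ℂ) (N a b c d : ℤ) : Summable (T q N a b c d) :=
  summable_of_hasFiniteSupport (T_supp q N a b c d)

lemma S_shift (q : ℂ) (N a b c d : ℤ) : S q (N + 1) a b c d = S q N a b (c + 3) (d + 2) := by
  unfold S
  congr 1; funext x
  unfold T
  rw [show 3 * (N + 1 - 2 * x.2 - x.1) + c = 3 * (N - 2 * x.2 - x.1) + (c + 3) by ring,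
    show 2 * (N + 1 - 2 * x.2 - x.1) + x.2 + d = 2 * (N - 2 * x.2 - x.1) + x.2 + (d + 2) by ring]

lemma S_R1 {q : ℂ} (hq : q ≠ 0) (h : ∀ k : ℕ, 0 < k → q ^ k ≠ 1) (N a b c d : ℤ)
    (hv : ∀ M : ℤ, 3 * M + c = 0 → 2 * M + d < 0) :
    S q N a b c d = S q N a b (c - 1) d + q ^ (3 * N + a + c - 2) * S q (N - 1) a b (c - 1) d := by
  have e2 : S q (N - 1) a b (c - 1) d
      = ∑' x : ℤ × ℤ, T q (N - 1) a b (c - 1) d ((Equiv.subRight ((1 : ℤ), (0 : ℤ))) x) :=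
    ((Equiv.subRight ((1 : ℤ), (0 : ℤ))).tsum_eq (T q (N - 1) a b (c - 1) d)).symm
  have s2 : Summable fun x : ℤ × ℤ =>
      T q (N - 1) a b (c - 1) d ((Equiv.subRight ((1 : ℤ), (0 : ℤ))) x) :=
    (T_summable q (N - 1) a b (c - 1) d).comp_injective
      (Equiv.subRight ((1 : ℤ), (0 : ℤ))).injective
  rw [e2, ← tsum_mul_left]
  unfold S
  rw [← (T_summable q N a b (c - 1) d).tsum_add (s2.mul_left _)]
  congr 1; funext ⟨m, n⟩
  simp only [Equiv.subRight_apply, T, Prod.mk_sub_mk, sub_zero]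
  by_cases hb : 3 * (N - 2 * n - m) + c = 0 ∧ m = 0
  · have := hv _ hb.1
    rw [qB_lt (q ^ 3) (show 2 * (N - 2 * n - m) + n + d < n by omega),
      qB_lt (q ^ 3) (show 2 * (N - 1 - 2 * n - (m - 1)) + n + d < n by omega)]
    simp
  · have hp := pascal1 hq h (3 * (N - 2 * n - m) + c) m (fun h1 h2 => hb ⟨h1, h2⟩)
    rw [hp, show 3 * (N - 1 - 2 * n - (m - 1)) + (c - 1) = 3 * (N - 2 * n - m) + c - 1 by ring,
      show 3 * (N - 2 * n - m) + (c - 1) = 3 * (N - 2 * n - m) + c - 1 by ring,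
      show 2 * (N - 1 - 2 * n - (m - 1)) + n + d = 2 * (N - 2 * n - m) + n + d by ring]
    have e : q ^ (2 * m ^ 2 + 6 * m * n + 6 * n ^ 2 + a * m + b * n)
        * q ^ (3 * (N - 2 * n - m) + c - m) = q ^ (3 * N + a + c - 2) *
        q ^ (2 * (m - 1) ^ 2 + 6 * (m - 1) * n + 6 * n ^ 2 + a * (m - 1) + b * n) := by
      rw [← zpow_add₀ hq, ← zpow_add₀ hq]; congr 1; ring
    linear_combination e * qBinom (3 * (N - 2 * n - m) + c - 1) (m - 1) q *
      qBinom (2 * (N - 2 * n - m) + n + d) n (q ^ 3)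

lemma S_R3 {q : ℂ} (hq : q ≠ 0) (h : ∀ k : ℕ, 0 < k → q ^ k ≠ 1) (N a b c d : ℤ)
    (hv : ∀ M : ℤ, 2 * M + d = 0 → 3 * M + c < N - M) :
    S q N a b c d = S q N a b c (d - 1) + q ^ (6 * N - 6 + b + 3 * d) * S q (N - 2) a b c d := by
  have e2 : S q (N - 2) a b c d
      = ∑' x : ℤ × ℤ, T q (N - 2) a b c d ((Equiv.subRight ((0 : ℤ), (1 : ℤ))) x) :=
    ((Equiv.subRight ((0 : ℤ), (1 : ℤ))).tsum_eq (T q (N - 2) a b c d)).symm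
  have s2 : Summable fun x : ℤ × ℤ =>
      T q (N - 2) a b c d ((Equiv.subRight ((0 : ℤ), (1 : ℤ))) x) :=
    (T_summable q (N - 2) a b c d).comp_injective
      (Equiv.subRight ((0 : ℤ), (1 : ℤ))).injective
  rw [e2, ← tsum_mul_left]
  unfold S
  rw [← (T_summable q N a b c (d - 1)).tsum_add (s2.mul_left _)]
  congr 1; funext ⟨m, n⟩
  simp only [Equiv.subRight_apply, T, Prod.mk_sub_mk, sub_zero]
  by_cases hb : 2 * (N - 2 * n - m) + n + d = 0 ∧ n = 0
  · have := hv (N - 2 * n - m) (by omega)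
    rw [qB_lt q (show 3 * (N - 2 * n - m) + c < m by omega),
      qB_lt q (show 3 * (N - 2 - 2 * (n - 1) - m) + c < m by omega)]
    simp
  · have hp := pascal1 (pow_ne_zero 3 hq) (cube_nr h) (2 * (N - 2 * n - m) + n + d) n
      (fun h1 h2 => hb ⟨h1, h2⟩)
    rw [hp, show 2 * (N - 2 - 2 * (n - 1) - m) + (n - 1) + d = 2 * (N - 2 * n - m) + n + d - 1 by ring,
      show 2 * (N - 2 * n - m) + n + (d - 1) = 2 * (N - 2 * n - m) + n + d - 1 by ring,
      show 3 * (N - 2 - 2 * (n - 1) - m) + c = 3 * (N - 2 * n - m) + c by ring]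
    have e : q ^ (2 * m ^ 2 + 6 * m * n + 6 * n ^ 2 + a * m + b * n)
        * (q ^ 3) ^ (2 * (N - 2 * n - m) + n + d - n) = q ^ (6 * N - 6 + b + 3 * d) *
        q ^ (2 * m ^ 2 + 6 * m * (n - 1) + 6 * (n - 1) ^ 2 + a * m + b * (n - 1)) := by
      rw [← zpow_natCast q 3, ← zpow_mul, ← zpow_add₀ hq, ← zpow_add₀ hq]
      congr 1; push_cast; ring
    linear_combination e * qBinom (3 * (N - 2 * n - m) + c) m q *
      qBinom (2 * (N - 2 * n - m) + n + d - 1) (n - 1) (q ^ 3)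

/-- The common recurrence (with `Z = q^(3r)`). -/
def Rec (q : ℂ) (e : ℤ → ℂ) : Prop := ∀ r : ℤ, -1 ≤ r →
  e (r + 3) = (1 + q ^ (3 * r) * q ^ 9) * e (r + 2)
    + ((q ^ 2 + q ^ 4) * (q ^ (3 * r) * q ^ 6) + (q ^ (3 * r) * q ^ 9) ^ 2) * e (r + 1)
    + (q ^ (3 * r)) ^ 2 * q ^ 15 * (1 - q ^ (3 * r) * q ^ 6) * e r

lemma zc {q : ℂ} (hq : q ≠ 0) (r x : ℤ) (i k : ℕ) (hx : x = i * (3 * r) + k) :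
    q ^ x = (q ^ (3 * r)) ^ i * q ^ k := by
  rw [hx, zpow_add₀ hq, mul_comm (i : ℤ), zpow_mul, zpow_natCast, zpow_natCast]

lemma S_R1' {q : ℂ} (hq : q ≠ 0) (h : ∀ k : ℕ, 0 < k → q ^ k ≠ 1) (r a b d N N' c c' : ℤ) (k : ℕ)
    (hN : N' = N - 1) (hc : c' = c - 1)
    (hk : 3 * N + a + c - 2 = 3 * r + k)
    (hv : ∀ M : ℤ, 3 * M + c = 0 → 2 * M + d < 0) :
    S q N a b c d = S q N a b c' d + q ^ (3 * r) * q ^ k * S q N' a b c' d := by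
  rw [S_R1 hq h N a b c d hv, hN, hc, zc hq r _ 1 k (by rw [hk]; push_cast; ring), pow_one]

lemma S_R1z {q : ℂ} (hq : q ≠ 0) (h : ∀ k : ℕ, 0 < k → q ^ k ≠ 1) (r a b N N' N'' : ℤ) (k : ℕ)
    (hN : N' = N - 1) (hN' : N'' = N - 2)
    (hk : 3 * N + a - 2 = 3 * r + k) :
    S q N a b 0 (-1) = S q N' a b 2 1 + q ^ (3 * r) * q ^ k * S q N'' a b 2 1 := by
  rw [S_R1' hq h r a b (-1) N N' 0 (-1) k hN (by norm_num) (by linarith) (by intro M hM; omega)]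
  have h1 := S_shift q N' a b (-1) (-1)
  have h2 := S_shift q N'' a b (-1) (-1)
  norm_num at h1 h2
  rw [show N' + 1 = N by omega] at h1
  rw [show N'' + 1 = N' by omega] at h2
  rw [h1, h2]

lemma S_R3' {q : ℂ} (hq : q ≠ 0) (h : ∀ k : ℕ, 0 < k → q ^ k ≠ 1) (r a b c N N' d d' : ℤ) (k : ℕ)
    (hN : N' = N - 2) (hc : d' = d - 1)
    (hk : 6 * N - 6 + b + 3 * d = 6 * r + k)
    (hv : ∀ M : ℤ, 2 * M + d = 0 → 3 * M + c < N - M) :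
    S q N a b c d = S q N a b c d' + (q ^ (3 * r)) ^ 2 * q ^ k * S q N' a b c d := by
  rw [S_R3 hq h N a b c d hv, hN, hc, zc hq r _ 2 k (by rw [hk]; push_cast; ring)]

lemma rec1 {q : ℂ} (hq : q ≠ 0) (h : ∀ k : ℕ, 0 < k → q ^ k ≠ 1) :
    Rec q (fun N => S q N 1 3 2 1) := by
  intro r hr
  have a1 := S_R1z hq h r 1 3 (r+3) (r+2) (r+1) 8 (by ring) (by ring) (by push_cast; ring)
  have a2 := S_R1' hq h r 1 3 (-1) (r+3) (r+2) 1 0 9 (by ring) (by ring) (by push_cast; ring)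
    (by intro M hM; omega)
  have a3 := S_R1' hq h r 1 3 0 (r+3) (r+2) 2 1 10 (by ring) (by ring) (by push_cast; ring)
    (by intro M hM; omega)
  have a4 := S_R1z hq h r 1 3 (r+2) (r+1) r 5 (by ring) (by ring) (by push_cast; ring)
  have a5 := S_R1' hq h r 1 3 0 (r+2) (r+1) 1 0 6 (by ring) (by ring) (by push_cast; ring)
    (by intro M hM; omega)
  have a6 := S_R1' hq h r 1 3 0 (r+2) (r+1) 2 1 7 (by ring) (by ring) (by push_cast; ring)
    (by intro M hM; omega)
  have a7 := S_R1' hq h r 1 3 0 (r+1) r 1 0 3 (by ring) (by ring) (by push_cast; ring)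
    (by intro M hM; omega)
  have a8 := S_R3' hq h r 1 3 1 (r+3) (r+1) 0 (-1) 15 (by ring) (by ring) (by push_cast; ring)
    (by intro M hM; omega)
  have a9 := S_R3' hq h r 1 3 2 (r+3) (r+1) 1 0 18 (by ring) (by ring) (by push_cast; ring)
    (by intro M hM; omega)
  have a10 := S_R3' hq h r 1 3 0 (r+2) r 0 (-1) 9 (by ring) (by ring) (by push_cast; ring)
    (by intro M hM; omega)
  have a11 := S_R3' hq h r 1 3 2 (r+2) r 1 0 12 (by ring) (by ring) (by push_cast; ring)
    (by intro M hM; omega)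
  dsimp only
  generalize q ^ (3 * r) = Z at *
  linear_combination a1 + a2 + a3 + Z * q ^ 10 * a4 + Z * (q ^ 10 - q ^ 9) * a5 - Z * q ^ 9 * a6
    + Z ^ 2 * (q ^ 15 - q ^ 16) * a7 + a8 + a9 + Z * (q ^ 10 - q ^ 9) * a10 - Z * q ^ 9 * a11

lemma rec2 {q : ℂ} (hq : q ≠ 0) (h : ∀ k : ℕ, 0 < k → q ^ k ≠ 1) :
    Rec q (fun N => S q N 3 6 0 0) := by
  intro r hr
  have a1 := S_R1z hq h r 3 6 (r+3) (r+2) (r+1) 10 (by ring) (by ring) (by push_cast; ring)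
  have a2 := S_R1z hq h r 3 6 (r+2) (r+1) r 7 (by ring) (by ring) (by push_cast; ring)
  have a3 := S_R1' hq h r 3 6 0 (r+2) (r+1) 1 0 8 (by ring) (by ring) (by push_cast; ring)
    (by intro M hM; omega)
  have a4 := S_R1' hq h r 3 6 0 (r+2) (r+1) 2 1 9 (by ring) (by ring) (by push_cast; ring)
    (by intro M hM; omega)
  have a5 := S_R1' hq h r 3 6 1 (r+2) (r+1) 2 1 9 (by ring) (by ring) (by push_cast; ring)
    (by intro M hM; omega)
  have a6 := S_R1' hq h r 3 6 0 (r+1) r 1 0 5 (by ring) (by ring) (by push_cast; ring)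
    (by intro M hM; omega)
  have a7 := S_R1' hq h r 3 6 1 (r+1) r 2 1 6 (by ring) (by ring) (by push_cast; ring)
    (by intro M hM; omega)
  have a8 := S_R3' hq h r 3 6 0 (r+3) (r+1) 0 (-1) 18 (by ring) (by ring) (by push_cast; ring)
    (by intro M hM; omega)
  have a9 := S_R3' hq h r 3 6 0 (r+2) r 0 (-1) 12 (by ring) (by ring) (by push_cast; ring)
    (by intro M hM; omega)
  have a10 := S_R3' hq h r 3 6 1 (r+2) r 1 0 15 (by ring) (by ring) (by push_cast; ring)
    (by intro M hM; omega)
  have a11 := S_R3' hq h r 3 6 2 (r+2) r 1 0 15 (by ring) (by ring) (by push_cast; ring)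
    (by intro M hM; omega)
  dsimp only
  generalize q ^ (3 * r) = Z at *
  linear_combination a1 - Z * q ^ 9 * a2 + a3 + q * a4 + (1 - q) * a5 + Z * q ^ 10 * a6
    + Z * (q ^ 10 - q ^ 9) * a7 + a8 - Z * q ^ 9 * a9 + (1 - q) * a10 + q * a11

/-- The product on the right-hand side. -/
noncomputable def W (q : ℂ) (l : ℕ) : ℂ := qPoch (-q) (q ^ 6) (l + 1) * qPoch (-q ^ 5) (q ^ 6) l

lemma W_succ (q : ℂ) (l : ℕ) :
    W q (l + 1) = W q l * ((1 + q ^ (6 * l + 7)) * (1 + q ^ (6 * l + 5))) := by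
  simp only [W, qPoch_succ _ _ (l + 1), qPoch_succ (-q ^ 5) _ l]
  rw [← pow_mul, ← pow_mul]; ring

/-- The summand on the right-hand side. -/
noncomputable def U (q : ℂ) (N : ℤ) (l : ℕ) : ℂ :=
  q ^ (3 * (((N - 2 * l) * (N - 2 * l - 1)) / 2)) *
        qBinom (N + 1) (2 * (l : ℤ) + 1) (q ^ 3) * W q l

/-- The telescoping certificate; here `N = r + 3`. -/
noncomputable def G (q : ℂ) (r : ℤ) (l : ℕ) : ℂ :=
  q ^ (3 * (((r + 3 - 2 * l) * (r + 3 - 2 * l + 1)) / 2)) *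
        qBinom (r + 2) (2 * (l : ℤ) - 1) (q ^ 3) * W q l

lemma tri (x : ℤ) : 2 * ((x * (x - 1)) / 2) = x * (x - 1) :=
  Int.mul_ediv_cancel' (Int.even_mul_pred_self x).two_dvd

lemma tri' (x : ℤ) : 2 * ((x * (x + 1)) / 2) = x * (x + 1) :=
  Int.mul_ediv_cancel' (Int.even_mul_succ_self x).two_dvd

lemma cube_zpow (q : ℂ) (x : ℤ) : (q ^ 3) ^ x = q ^ (3 * x) := by
  rw [← zpow_natCast q 3, ← zpow_mul]; push_cast; rfl

lemma zc2 {q : ℂ} (hq : q ≠ 0) (t y x : ℤ) (i k : ℕ) (hx : x = 3 * t + i * (3 * y) + k) :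
    q ^ x = q ^ (3 * t) * (q ^ (3 * y)) ^ i * q ^ k := by
  rw [hx, zpow_add₀ hq, zpow_add₀ hq, mul_comm (i : ℤ), zpow_mul q (3 * y), zpow_natCast,
    zpow_natCast]

lemma tele {q : ℂ} (hq : q ≠ 0) (h : ∀ k : ℕ, 0 < k → q ^ k ≠ 1) (r : ℤ) (hr : -1 ≤ r) (l : ℕ) :
    U q (r + 3) l - (1 + q ^ (3 * r) * q ^ 9) * U q (r + 2) l
    - ((q ^ 2 + q ^ 4) * (q ^ (3 * r) * q ^ 6) + (q ^ (3 * r) * q ^ 9) ^ 2) * U q (r + 1) l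
    - (q ^ (3 * r)) ^ 2 * q ^ 15 * (1 - q ^ (3 * r) * q ^ 6) * U q r l = G q r l - G q r (l + 1) := by
  have hp : q ^ 3 ≠ 0 := pow_ne_zero 3 hq
  have h3 := cube_nr h
  have pe := pascal2 hp h3 (r + 4) (2 * l + 1) (by omega)
  have pd := pascal1 hp h3 (r + 3) (2 * l) (by omega)
  have pb := pascal1 hp h3 (r + 3) (2 * l + 1) (by omega)
  have ab := absorb h3 (r + 2) (2 * l + 1)
  simp only [cube_zpow] at pe pd pb ab
  obtain ⟨y, hy⟩ : ∃ y : ℤ, y = r - 2 * l := ⟨_, rfl⟩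
  obtain ⟨t, ht⟩ : ∃ t : ℤ, t = (r - 2 * l) * (r - 2 * l - 1) / 2 := ⟨_, rfl⟩
  have T0 := tri (r - 2 * l)
  have T1 := tri (r + 1 - 2 * l)
  have T2 := tri (r + 2 - 2 * l)
  have T3 := tri (r + 3 - 2 * l)
  have T4 := tri' (r + 3 - 2 * l)
  have T5 := tri' (r + 3 - 2 * ((l + 1 : ℕ) : ℤ))
  rw [← ht] at T0
  have E1 := zc2 hq t y (3 * ((r + 1 - 2 * l) * (r + 1 - 2 * l - 1) / 2)) 1 0
    (by push_cast; subst hy; linarith)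
  have E2 := zc2 hq t y (3 * ((r + 2 - 2 * l) * (r + 2 - 2 * l - 1) / 2)) 2 3
    (by push_cast; subst hy; linarith)
  have E3 := zc2 hq t y (3 * ((r + 3 - 2 * l) * (r + 3 - 2 * l - 1) / 2)) 3 9
    (by push_cast; subst hy; linarith)
  have E4 := zc2 hq t y (3 * ((r + 3 - 2 * l) * (r + 3 - 2 * l + 1) / 2)) 4 18
    (by push_cast; subst hy; linarith)
  have E5 := zc2 hq t y (3 * ((r + 3 - 2 * ((l + 1 : ℕ) : ℤ)) * (r + 3 - 2 * ((l + 1 : ℕ) : ℤ) + 1) / 2))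
    2 3 (by push_cast at T5 ⊢; subst hy; linarith)
  have F1 : q ^ (3 * (2 * (l : ℤ) + 1)) = q ^ (6 * l) * q ^ 3 := by
    rw [← pow_add, ← zpow_natCast]; congr 1; push_cast; ring
  have F2 : q ^ (3 * (r + 3 - 2 * (l : ℤ))) = q ^ (3 * y) * q ^ 9 := by
    rw [← zpow_natCast q 9, ← zpow_add₀ hq]; congr 1; push_cast; rw [hy]; ring
  have F3 : q ^ (3 * (r + 3 - (2 * (l : ℤ) + 1))) = q ^ (3 * y) * q ^ 6 := by
    rw [← zpow_natCast q 6, ← zpow_add₀ hq]; congr 1; push_cast; rw [hy]; ring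
  have F4 : q ^ (3 * (r + 2 - (2 * (l : ℤ) + 1))) = q ^ (3 * y) * q ^ 3 := by
    rw [← zpow_natCast q 3, ← zpow_add₀ hq]; congr 1; push_cast; rw [hy]; ring
  have F5 : q ^ (3 * (r + 2)) = q ^ (3 * y) * q ^ (6 * l) * q ^ 6 := by
    rw [← zpow_natCast q 6, ← zpow_natCast q (6 * l), ← zpow_add₀ hq, ← zpow_add₀ hq]
    congr 1; push_cast; rw [hy]; ring
  have F6 : q ^ (3 * r) = q ^ (3 * y) * q ^ (6 * l) := by
    rw [← zpow_natCast q (6 * l), ← zpow_add₀ hq]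
    congr 1; push_cast; rw [hy]; ring
  rw [F1] at pe
  rw [F2] at pd
  rw [F3] at pb
  rw [F4, F5] at ab
  unfold U G
  rw [E1, E2, E3, E4, E5, F6, W_succ, ← ht, pow_add q (6 * l) 7, pow_add q (6 * l) 5]
  rw [show r + 3 + 1 = r + 4 by ring, show r + 2 + 1 = r + 3 by ring, show r + 1 + 1 = r + 2 by ring,
    show 2 * ((l + 1 : ℕ) : ℤ) - 1 = 2 * l + 1 by push_cast; ring]
  rw [show r + 4 - 1 = r + 3 by ring, show 2 * (l : ℤ) + 1 - 1 = 2 * l by ring] at pe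
  rw [show r + 3 - 1 = r + 2 by ring] at pd
  rw [show r + 3 - 1 = r + 2 by ring, show 2 * (l : ℤ) + 1 - 1 = 2 * l by ring] at pb
  rw [show r + 2 - 1 = r + 1 by ring] at ab
  generalize q ^ (3 * y) = Y at *
  generalize q ^ (3 * t) = E at *
  generalize q ^ (6 * l) = J at *
  linear_combination (E * W q l * Y ^ 2 * q ^ 3) * (Y * q ^ 6 * pe + Y * q ^ 6 * pd - pb)
    - (Y * J) ^ 2 * q ^ 15 * E * W q l * ab

/-- The right-hand side. -/
noncomputable def R (q : ℂ) (N : ℤ) : ℂ := ∑ l ∈ Finset.range (N.toNat + 1), U q N l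

lemma R_eq (q : ℂ) (N : ℤ) (K : ℕ) (hK : N.toNat + 1 ≤ K) :
    R q N = ∑ l ∈ Finset.range K, U q N l := by
  unfold R
  apply Finset.sum_subset
  · intro x; simp only [Finset.mem_range]; omega
  · intro x _ hx
    simp only [Finset.mem_range] at hx
    unfold U
    rw [qB_lt (q ^ 3) (show N + 1 < 2 * (x : ℤ) + 1 by omega)]
    simp

lemma recR {q : ℂ} (hq : q ≠ 0) (h : ∀ k : ℕ, 0 < k → q ^ k ≠ 1) : Rec q (R q) := by
  intro r hr
  have hK : ∃ K : ℕ, (r + 3).toNat + 1 ≤ K := ⟨_, le_rfl⟩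
  obtain ⟨K, hK⟩ := hK
  rw [R_eq q (r + 3) K hK, R_eq q (r + 2) K (by omega), R_eq q (r + 1) K (by omega),
    R_eq q r K (by omega)]
  have hs := Finset.sum_congr (rfl : Finset.range K = Finset.range K)
    (fun l _ => tele hq h r hr l)
  rw [Finset.sum_range_sub'] at hs
  have g0 : G q r 0 = 0 := by
    unfold G
    rw [qB_neg (q ^ 3) (show 2 * ((0 : ℕ) : ℤ) - 1 < 0 by norm_num)]; simp
  have gK : G q r K = 0 := by
    unfold G
    rw [qB_lt (q ^ 3) (show r + 2 < 2 * ((K : ℕ) : ℤ) - 1 by omega)]; simp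
  rw [g0, gK] at hs
  simp only [Finset.sum_sub_distrib, ← Finset.mul_sum] at hs
  linear_combination hs

lemma rec_unique {q : ℂ} {e f : ℤ → ℂ} (he : Rec q e) (hf : Rec q f)
    (h1 : e (-1) = f (-1)) (h2 : e 0 = f 0) (h3 : e 1 = f 1) (N : ℕ) : e N = f N := by
  have key : ∀ n : ℕ, e ((n : ℤ) - 1) = f ((n : ℤ) - 1) ∧ e n = f n ∧ e ((n : ℤ) + 1) = f ((n : ℤ) + 1) := by
    intro n
    induction n with
    | zero => simpa using ⟨h1, h2, h3⟩
    | succ n ih =>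
      obtain ⟨i1, i2, i3⟩ := ih
      have r1 := he ((n : ℤ) - 1) (by omega)
      have r2 := hf ((n : ℤ) - 1) (by omega)
      rw [show (n : ℤ) - 1 + 3 = n + 1 + 1 by ring, show (n : ℤ) - 1 + 2 = n + 1 by ring,
        show (n : ℤ) - 1 + 1 = n by ring] at r1 r2
      push_cast
      refine ⟨by simpa using i2, i3, ?_⟩
      rw [r1, r2, i1, i2, i3]
  exact (key N).2.1

lemma S_nat (q : ℂ) (N a b c d : ℤ) :
    S q N a b c d = ∑' m : ℕ, ∑' n : ℕ, T q N a b c d ((m : ℤ), (n : ℤ)) := by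
  have hi : Function.Injective (fun x : ℕ × ℕ => ((x.1 : ℤ), (x.2 : ℤ))) := by
    rintro ⟨a, b⟩ ⟨c, d⟩ hh
    simpa using hh
  have h1 : S q N a b c d = ∑' x : ℕ × ℕ, T q N a b c d ((x.1 : ℤ), (x.2 : ℤ)) := by
    symm
    apply hi.tsum_eq
    intro x hx
    by_contra hn
    apply hx
    apply T_zero
    rintro ⟨h1, h2, _⟩
    exact hn ⟨(x.1.toNat, x.2.toNat), by ext <;> simp [h1, h2]⟩
  rw [h1]
  exact ((T_summable q N a b c d).comp_injective hi).tsum_prod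

lemma S_neg (q : ℂ) (a b c d : ℤ) (hd : d ≤ 1) : S q (-1) a b c d = 0 := by
  unfold S
  have : T q (-1) a b c d = fun _ => 0 := by
    funext x; apply T_zero; omega
  rw [this, tsum_zero]

lemma S_0 {q : ℂ} (h : ∀ k : ℕ, 0 < k → q ^ k ≠ 1) (a b c d : ℤ) (hc : 0 ≤ c)
    (hd0 : 0 ≤ d) (hd : d ≤ 1) : S q 0 a b c d = 1 := by
  unfold S
  rw [tsum_eq_single ((0 : ℤ), (0 : ℤ))]
  · simp [T, qB_zero h hc, qB_zero (cube_nr h) hd0]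
  · intro x hx
    apply T_zero
    rintro ⟨h1, h2, h3⟩
    apply hx
    ext <;> dsimp only <;> omega

lemma S_1 {q : ℂ} (h : ∀ k : ℕ, 0 < k → q ^ k ≠ 1) (a b c d : ℤ) (hc : 0 ≤ c)
    (hd0 : 0 ≤ d) (hd : d ≤ 1) : S q 1 a b c d = 1 + q ^ (2 + a) * qBinom c 1 q := by
  unfold S
  rw [tsum_eq_sum (s := {((0 : ℤ), (0 : ℤ)), ((1 : ℤ), (0 : ℤ))})]
  · rw [Finset.sum_pair (by simp)]
    simp [T, qB_zero h (show 0 ≤ 3 + c by omega), qB_zero (cube_nr h) (show 0 ≤ 2 + d by omega),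
      qB_zero (cube_nr h) hd0]
  · intro x hx
    apply T_zero
    rintro ⟨h1, h2, h3⟩
    apply hx
    simp only [Finset.mem_insert, Finset.mem_singleton, Prod.ext_iff]
    omega

lemma qB21 {q : ℂ} (hq : q ≠ 0) (h : ∀ k : ℕ, 0 < k → q ^ k ≠ 1) : qBinom 2 1 q = 1 + q := by
  have := pascal1 hq h 2 1 (by norm_num)
  norm_num at this
  rw [this, qB_self h (by norm_num), qB_zero h (by norm_num)]; ring

lemma W0 (q : ℂ) : W q 0 = 1 + q := by
  simp [W, qPoch]

lemma R_neg (q : ℂ) : R q (-1) = 0 := by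
  simp [R, U, qB_lt]

lemma R_0 {q : ℂ} (h : ∀ k : ℕ, 0 < k → q ^ k ≠ 1) : R q 0 = 1 + q := by
  simp [R, U, W0, qB_self (cube_nr h)]

lemma R_1 {q : ℂ} (hq : q ≠ 0) (h : ∀ k : ℕ, 0 < k → q ^ k ≠ 1) :
    R q 1 = (1 + q ^ 3) * (1 + q) := by
  have h1 : R q 1 = ∑ l ∈ Finset.range 2, U q 1 l := rfl
  rw [h1, Finset.sum_range_succ, Finset.sum_range_one]
  have h2 : U q 1 1 = 0 := by
    unfold U
    rw [qB_lt (q ^ 3) (by norm_num)]; simp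
  have h3 : U q 1 0 = (1 + q ^ 3) * (1 + q) := by
    unfold U
    norm_num [W0, qB21 (pow_ne_zero 3 hq) (cube_nr h)]
  rw [h2, h3, add_zero]

lemma main {q : ℂ} (hq : q ≠ 0) (h : ∀ k : ℕ, 0 < k → q ^ k ≠ 1) (N : ℕ) :
    S q N 1 3 2 1 + q * S q N 3 6 0 0 = R q N := by
  refine rec_unique (q := q) (e := fun N => S q N 1 3 2 1 + q * S q N 3 6 0 0) (f := R q)
    ?_ (recR hq h) ?_ ?_ ?_ N
  · intro r hr
    have h1 := rec1 hq h r hr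
    have h2 := rec2 hq h r hr
    dsimp only at h1 h2 ⊢
    linear_combination h1 + q * h2
  · simp [S_neg, R_neg]
  · simp [S_0 h, R_0 h]
  · simp only [R_1 hq h, S_1 h 1 3 2 1 (by norm_num) (by norm_num) (by norm_num),
      S_1 h 3 6 0 0 (by norm_num) (by norm_num) (by norm_num), qB21 hq h,
      qB_lt q (show (0 : ℤ) < 1 by norm_num)]
    norm_num
    ring

end CapAux

theorem finite_capparelli_two_N (N : ℕ) (q : ℂ) (hq : q ≠ 0) (hroot : ∀ k : ℕ, 0 < k → q ^ k ≠ 1) :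
    (∑' m : ℕ, ∑' n : ℕ, q ^ (Qcap m n + m + 3 * n) *
        qBinom (3 * ((N : ℤ) - 2 * n - m) + 2) (m : ℤ) q *
        qBinom (2 * ((N : ℤ) - 2 * n - m) + n + 1) (n : ℤ) (q ^ 3)) +
      (∑' m : ℕ, ∑' n : ℕ, q ^ (Qcap m n + 3 * m + 6 * n + 1) *
        qBinom (3 * ((N : ℤ) - 2 * n - m)) (m : ℤ) q *
        qBinom (2 * ((N : ℤ) - 2 * n - m) + n) (n : ℤ) (q ^ 3)) =
    ∑ l ∈ Finset.range (N + 1),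
      q ^ (3 * ((((N : ℤ) - 2 * l) * ((N : ℤ) - 2 * l - 1)) / 2)) *
        qBinom ((N : ℤ) + 1) (2 * (l : ℤ) + 1) (q ^ 3) *
        qPoch (-q) (q ^ 6) (l + 1) * qPoch (-q ^ 5) (q ^ 6) l := by
  have hm := CapAux.main hq hroot N
  rw [CapAux.S_nat, CapAux.S_nat, ← tsum_mul_left] at hm
  simp only [← tsum_mul_left] at hm
  convert hm using 1
  · congr 1
    · congr 1; funext m; congr 1; funext n
      unfold CapAux.T
      dsimp only
      rw [← zpow_natCast]
      congr 3
      unfold Qcap; push_cast; ring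
    · congr 1; funext m; congr 1; funext n
      unfold CapAux.T
      dsimp only
      rw [pow_succ', ← zpow_natCast, add_zero, add_zero, ← mul_assoc, ← mul_assoc]
      congr 4
  · unfold CapAux.R CapAux.U CapAux.W
    rw [Int.toNat_natCast]
    apply Finset.sum_congr rfl
    intro l _
    ring
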